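/- arXiv:1707.05439 — 2 statements merged into one kernel-verified Lean document; each statement's English description precedes it below -/
import Mathlib

section
/- If G is a connected finite simple graph with girth at least 5, maximum degree Δ, and diameter at least 4 (i.e., some two vertices are at distance at least 4), then χ_D(G) ≤ Δ + 1. -/
/-- A coloring `φ` of the vertices of `G` is a proper distinguishing coloring if adjacent
vertices get different colors and the only automorphism of `G` preserving all colors is
the identity. -/
def IsProperDistinguishingColoring {V α : Type*} (G : SimpleGraph V) (φ : V → α) : Prop :=
  (∀ u v, G.Adj u v → φ u ≠ φ v) ∧
    ∀ f : G ≃g G, (∀ v, φ (f v) = φ v) → ∀ v, f v = v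

/-- A vertex coloring is proper on `F` if adjacent vertices of `F` get different colors. -/
def ProperOn {V C : Type*} (G : SimpleGraph V) (φ : V → C) (F : Finset V) : Prop :=
  ∀ u ∈ F, ∀ v ∈ F, G.Adj u v → φ u ≠ φ v

/-- The vertices outside `F` whose only neighbor in `F` is `x`. -/
def privateNeighbors {V : Type*} [Fintype V] [DecidableEq V] (G : SimpleGraph V)
    [DecidableRel G.Adj] (F : Finset V) (x : V) : Finset V :=
  (G.neighborFinset x).filter fun w => w ∉ F ∧ ∀ u ∈ F, G.Adj w u → u = x

theorem not_triangle_of_five_le_girth {V : Type*} {G : SimpleGraph V} (h : 5 ≤ G.girth)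
    {a b c : V} (hab : G.Adj a b) (hbc : G.Adj b c) : ¬ G.Adj c a := by
  intro hca
  have hc : (SimpleGraph.Walk.cons hab (.cons hbc (.cons hca .nil))).IsCycle := by
    rw [SimpleGraph.Walk.isCycle_def, SimpleGraph.Walk.isTrail_def]
    have := hab.ne
    have := hbc.ne
    have := hca.ne
    simp
    grind
  have := hc.girth_le_length
  simp at this
  omega

theorem eq_of_common_neighbors_of_five_le_girth {V : Type*} {G : SimpleGraph V}
    (h : 5 ≤ G.girth) {a b x y : V} (hab : a ≠ b) (hax : G.Adj a x) (hbx : G.Adj b x)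
    (hay : G.Adj a y) (hby : G.Adj b y) : x = y := by
  by_contra hxy
  have hc : (SimpleGraph.Walk.cons hax (.cons hbx.symm
      (.cons hby (.cons hay.symm .nil)))).IsCycle := by
    rw [SimpleGraph.Walk.isCycle_def, SimpleGraph.Walk.isTrail_def]
    have := hax.ne
    have := hbx.ne
    have := hay.ne
    have := hby.ne
    simp
    grind
  have := hc.girth_le_length
  simp at this
  omega

theorem exists_injOn_mapsTo_apply_eq {V C : Type*} [DecidableEq C] {P : Finset V}
    {A : Finset C} (hPA : P.card ≤ A.card) {y : V} (hy : y ∈ P) {c : C} (hc : c ∈ A) :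
    ∃ g : V → C, (∀ p ∈ P, g p ∈ A) ∧ Set.InjOn g P ∧ g y = c := by
  classical
  have : Nonempty C := ⟨c⟩
  obtain ⟨g, hg, hinj⟩ := P.finite_toSet.exists_injOn_of_encard_le (t := (A : Set C))
    (by simpa using hPA)
  have hgA : ∀ p ∈ P, g p ∈ A := fun p hp => by simpa using hg hp
  refine ⟨fun p => Equiv.swap (g y) c (g p), fun p hp => ?_, fun a ha b hb hab =>
    hinj ha hb ((Equiv.swap (g y) c).injective hab), Equiv.swap_apply_left _ _⟩
  have := hgA p hp
  have := hgA y hy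
  grind

theorem SimpleGraph.Connected.exists_adj_notMem {V : Type*} [Fintype V]
    {G : SimpleGraph V} (hconn : G.Connected) {F : Finset V} (hne : F.Nonempty)
    (hF : F ≠ Finset.univ) : ∃ x ∈ F, ∃ w ∉ F, G.Adj x w := by
  obtain ⟨a, ha⟩ := hne
  obtain ⟨b, hb⟩ : ∃ b, b ∉ F := by simpa [Finset.eq_univ_iff_forall] using hF
  obtain ⟨p⟩ := hconn.preconnected a b
  obtain ⟨e, -, h1, h2⟩ := p.exists_boundary_dart (F : Set V) (by simpa) (by simpa)
  exact ⟨e.fst, by simpa using h1, e.snd, by simpa using h2, e.adj⟩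

section

variable {V C : Type*} [Fintype V] [DecidableEq V] {G : SimpleGraph V} [DecidableRel G.Adj]

theorem mem_privateNeighbors {F : Finset V} {x w : V} :
    w ∈ privateNeighbors G F x ↔
      G.Adj x w ∧ w ∉ F ∧ ∀ u ∈ F, G.Adj w u → u = x := by
  simp [privateNeighbors]

theorem card_privateNeighbors_lt {F : Finset V} {x u : V} (hu : u ∈ F) (hxu : G.Adj x u) :
    (privateNeighbors G F x).card < G.degree x := by
  rw [← G.card_neighborFinset_eq_degree]
  apply Finset.card_lt_card
  refine ⟨Finset.filter_subset _ _, fun h => ?_⟩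
  exact (mem_privateNeighbors.1 (h (by simpa using hxu))).2.1 hu

theorem fixes_privateNeighbors {ψ : V → C} {F : Finset V} {x : V} (hx : x ∈ F)
    (hinj : Set.InjOn ψ (privateNeighbors G F x)) {f : G ≃g G}
    (hf : ∀ v, ψ (f v) = ψ v) (hF : ∀ v ∈ F, f v = v) :
    ∀ v ∈ F ∪ privateNeighbors G F x, f v = v := by
  intro v hv
  rcases Finset.mem_union.1 hv with hv | hv
  · exact hF v hv
  obtain ⟨hxv, hvF, hvu⟩ := mem_privateNeighbors.1 hv
  refine hinj (mem_privateNeighbors.2 ⟨?_, ?_, ?_⟩) hv (hf v)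
  · have := f.map_adj_iff.2 hxv
    rwa [hF x hx] at this
  · intro h
    exact hvF (f.injective (hF _ h) ▸ h)
  · intro u hu hadj
    rw [← hF u hu] at hadj
    exact hvu u hu (f.map_adj_iff.1 hadj)

theorem exists_adj_union_privateNeighbors {F : Finset V} {x : V} (hx : x ∈ F)
    (hF : ∀ v ∈ F, ∃ u ∈ F, G.Adj v u) :
    ∀ v ∈ F ∪ privateNeighbors G F x, ∃ u ∈ F ∪ privateNeighbors G F x, G.Adj v u := by
  intro v hv
  rcases Finset.mem_union.1 hv with hv | hv
  · obtain ⟨u, hu, h⟩ := hF v hv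
    exact ⟨u, Finset.mem_union_left _ hu, h⟩
  · exact ⟨x, Finset.mem_union_left _ hx, (mem_privateNeighbors.1 hv).1.symm⟩

variable [DecidableEq C]

theorem exists_coloring_union_privateNeighbors (hgirth : 5 ≤ G.girth) {F : Finset V}
    {φ : V → C} (hφ : ProperOn G φ F) {x : V} {A : Finset C} (hxA : φ x ∉ A)
    (hcard : (privateNeighbors G F x).card ≤ A.card) {y : V}
    (hy : y ∈ privateNeighbors G F x) {c : C} (hc : c ∈ A) :
    ∃ ψ : V → C, (∀ v ∈ F, ψ v = φ v) ∧ ProperOn G ψ (F ∪ privateNeighbors G F x) ∧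
      (∀ v ∈ privateNeighbors G F x, ψ v ∈ A) ∧
      Set.InjOn ψ (privateNeighbors G F x) ∧ ψ y = c := by
  obtain ⟨g, hgA, hginj, hgy⟩ := exists_injOn_mapsTo_apply_eq hcard hy hc
  have hnot : ∀ v ∈ privateNeighbors G F x, v ∉ F := fun v hv => (mem_privateNeighbors.1 hv).2.1
  have hcross : ∀ u ∈ F, ∀ v ∈ privateNeighbors G F x, G.Adj v u → φ u ≠ g v := by
    intro u hu v hv hadj heq
    rw [(mem_privateNeighbors.1 hv).2.2 u hu hadj] at heq
    exact hxA (heq ▸ hgA v hv)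
  refine ⟨fun v => if v ∈ F then φ v else g v, fun v hv => by simp [hv], ?_, ?_, ?_, ?_⟩
  · intro u hu v hv huv
    rcases Finset.mem_union.1 hu with hu | hu <;> rcases Finset.mem_union.1 hv with hv | hv
    · simpa [hu, hv] using hφ u hu v hv huv
    · simpa [hu, hnot v hv] using hcross u hu v hv huv.symm
    · simpa [hv, hnot u hu] using (hcross v hv u hu huv).symm
    · exact (not_triangle_of_five_le_girth hgirth (mem_privateNeighbors.1 hu).1 huv
        (mem_privateNeighbors.1 hv).1.symm).elim
  · intro v hv
    simpa [hnot v hv] using hgA v hv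
  · intro u hu v hv huv
    exact hginj hu hv (by simpa [hnot u hu, hnot v hv] using huv)
  · simpa [hnot y hy] using hgy

variable [Fintype C]

/-- Greedy choice of a color for `w`: a color outside the one to be avoided is available unless
the neighbors of `w` all lie in `F` and see every other color exactly once. -/
theorem exists_color_of_degree_le {d : ℕ} (hC : Fintype.card C = d + 1) (w : V)
    (hdeg : G.degree w ≤ d) (F : Finset V) (φ : V → C) (c₀ : C) :
    ∃ c : C, (∀ u ∈ F, G.Adj w u → φ u ≠ c) ∧
      (c = c₀ → (∀ u, G.Adj w u → u ∈ F) ∧ Set.InjOn φ (G.neighborFinset w) ∧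
        G.degree w = d) := by
  by_cases h : ∃ c, c ≠ c₀ ∧ ∀ u ∈ F, G.Adj w u → φ u ≠ c
  · obtain ⟨c, hc, h⟩ := h
    exact ⟨c, h, fun e => (hc e).elim⟩
  push Not at h
  set N := (G.neighborFinset w).filter (· ∈ F) with hN
  have hsub : N ⊆ G.neighborFinset w := Finset.filter_subset _ _
  have h1 : Finset.univ.erase c₀ ⊆ N.image φ := by
    intro c hc
    obtain ⟨u, hu, hwu, e⟩ := h c (Finset.ne_of_mem_erase hc)
    exact Finset.mem_image.2 ⟨u, by simp [hN, hu, hwu], e⟩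
  have h2 := Finset.card_le_card h1
  rw [Finset.card_erase_of_mem (Finset.mem_univ _), Finset.card_univ, hC] at h2
  have h3 : (N.image φ).card ≤ N.card := Finset.card_image_le
  have h4 := Finset.card_le_card hsub
  rw [G.card_neighborFinset_eq_degree] at h4
  have hNe : N = G.neighborFinset w :=
    Finset.eq_of_subset_of_card_le hsub (by rw [G.card_neighborFinset_eq_degree]; omega)
  have h5 : Finset.univ.erase c₀ = N.image φ :=
    Finset.eq_of_subset_of_card_le h1 (by
      rw [Finset.card_erase_of_mem (Finset.mem_univ _), Finset.card_univ, hC]; omega)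
  have hmem : ∀ u, G.Adj w u → u ∈ N := fun u hu => by rw [hNe]; simpa using hu
  refine ⟨c₀, fun u hu hwu e => ?_, fun _ => ⟨fun u hu => ?_, ?_, by omega⟩⟩
  · have := Finset.mem_image_of_mem φ (hmem u hwu)
    rw [← h5, e] at this
    simp at this
  · exact (Finset.mem_filter.1 (hmem u hu)).2
  · rw [← hNe]
    exact Finset.card_image_iff.1 (by omega)

/-- A partial proper coloring extends to a proper coloring that breaks every nontrivial
automorphism fixing the colored set pointwise; moreover the new vertices receive `c₀` only if
they have full degree and their neighbors get pairwise distinct colors. -/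
theorem exists_distinguishing_extension (hgirth : 5 ≤ G.girth) (hconn : G.Connected) {d : ℕ}
    (hC : Fintype.card C = d + 1) (hdeg : ∀ v, G.degree v ≤ d) (c₀ : C) (F : Finset V)
    (hne : F.Nonempty) (hF : ∀ v ∈ F, ∃ u ∈ F, G.Adj v u) (φ : V → C)
    (hφ : ProperOn G φ F) :
    ∃ ψ : V → C, (∀ v ∈ F, ψ v = φ v) ∧ (∀ u v, G.Adj u v → ψ u ≠ ψ v) ∧
      (∀ f : G ≃g G, (∀ v, ψ (f v) = ψ v) → (∀ v ∈ F, f v = v) → ∀ v, f v = v) ∧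
      ∀ v ∉ F, ψ v = c₀ → Set.InjOn ψ (G.neighborFinset v) ∧ G.degree v = d := by
  induction hn : Fᶜ.card using Nat.strong_induction_on generalizing F φ with
  | _ n ih =>
  by_cases huniv : F = Finset.univ
  · subst huniv
    exact ⟨φ, fun _ _ => rfl, fun u v => hφ u (Finset.mem_univ _) v (Finset.mem_univ _),
      fun f _ h v => h v (Finset.mem_univ _), fun v hv => (hv (Finset.mem_univ _)).elim⟩
  obtain ⟨x, hx, w, hw, hxw⟩ := hconn.exists_adj_notMem hne huniv
  by_cases htwo : ∃ a ∈ F, a ≠ x ∧ G.Adj w a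
  · obtain ⟨a, ha, hax, hwa⟩ := htwo
    obtain ⟨c, hc, hc₀⟩ := exists_color_of_degree_le hC w (hdeg w) F φ c₀
    have hlt : (insert w F)ᶜ.card < n := by
      rw [← hn]
      apply Finset.card_lt_card
      refine ⟨Finset.compl_subset_compl.2 (Finset.subset_insert _ _), fun h => ?_⟩
      have := h (Finset.mem_compl.2 hw)
      simp at this
    have hup : ∀ v ∈ F, Function.update φ w c v = φ v := fun v hv =>
      Function.update_of_ne (ne_of_mem_of_not_mem hv hw) _ _
    obtain ⟨ψ, hψ, hprop, hfix, hbad⟩ := ih _ hlt (insert w F) (by simp) (by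
        intro v hv
        rcases Finset.mem_insert.1 hv with rfl | hv
        · exact ⟨x, Finset.mem_insert_of_mem hx, hxw.symm⟩
        · obtain ⟨u, hu, h⟩ := hF v hv
          exact ⟨u, Finset.mem_insert_of_mem hu, h⟩) (Function.update φ w c) (by
        intro u hu v hv huv
        rw [Finset.mem_insert] at hu hv
        rcases hu with rfl | hu <;> rcases hv with rfl | hv
        · exact (huv.ne rfl).elim
        · rw [hup v hv, Function.update_self]
          exact (hc v hv huv).symm
        · rw [hup u hu, Function.update_self]
          exact hc u hu huv.symm
        · rw [hup u hu, hup v hv]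
          exact hφ u hu v hv huv) rfl
    have hψF : ∀ v ∈ F, ψ v = φ v := fun v hv =>
      (hψ v (Finset.mem_insert_of_mem hv)).trans (hup v hv)
    refine ⟨ψ, hψF, hprop, fun f hf hfF => hfix f hf ?_, fun v hv hv₀ => ?_⟩
    · intro v hv
      rcases Finset.mem_insert.1 hv with rfl | hv
      · have h1 := f.map_adj_iff.2 hxw
        have h2 := f.map_adj_iff.2 hwa
        rw [hfF x hx] at h1
        rw [hfF a ha] at h2
        exact eq_of_common_neighbors_of_five_le_girth hgirth hax h2.symm h1 hwa.symm hxw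
      · exact hfF v hv
    · by_cases hvw : v = w
      · subst hvw
        rw [hψ v (by simp), Function.update_self] at hv₀
        obtain ⟨h1, h2, h3⟩ := hc₀ hv₀
        refine ⟨fun a ha b hb hab => h2 ha hb ?_, h3⟩
        rwa [hψF a (h1 a (by simpa using ha)), hψF b (h1 b (by simpa using hb))] at hab
      · exact hbad v (by simp [hvw, hv]) hv₀
  · push Not at htwo
    have hwP : w ∈ privateNeighbors G F x := mem_privateNeighbors.2
      ⟨hxw, hw, fun u hu hwu => by_contra fun h => htwo u hu h hwu⟩
    have hcard : (privateNeighbors G F x).card ≤ (({c₀, φ x} : Finset C)ᶜ).card := by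
      obtain ⟨u, hu, hxu⟩ := hF x hx
      have h1 := card_privateNeighbors_lt hu hxu
      have h2 := hdeg x
      have h3 : ({c₀, φ x} : Finset C).card ≤ 2 := Finset.card_le_two
      rw [Finset.card_compl, hC]
      omega
    obtain ⟨c, hc⟩ : (({c₀, φ x} : Finset C)ᶜ).Nonempty :=
      Finset.card_pos.1 ((Finset.card_pos.2 ⟨w, hwP⟩).trans_le hcard)
    obtain ⟨φ', hφ'F, hφ', hA, hinj, -⟩ := exists_coloring_union_privateNeighbors hgirth hφ
      (by simp) hcard hwP hc
    have hlt : (F ∪ privateNeighbors G F x)ᶜ.card < n := by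
      rw [← hn]
      apply Finset.card_lt_card
      refine ⟨Finset.compl_subset_compl.2 Finset.subset_union_left, fun h => ?_⟩
      have := h (Finset.mem_compl.2 hw)
      simp [hwP] at this
    obtain ⟨ψ, hψ, hprop, hfix, hbad⟩ := ih _ hlt _ (hne.mono Finset.subset_union_left)
      (exists_adj_union_privateNeighbors hx hF) φ' hφ' rfl
    have hψP : ∀ v ∈ privateNeighbors G F x, ψ v = φ' v := fun v hv =>
      hψ v (Finset.mem_union_right _ hv)
    refine ⟨ψ, fun v hv => (hψ v (Finset.mem_union_left _ hv)).trans (hφ'F v hv), hprop,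
      fun f hf hfF => hfix f hf (fixes_privateNeighbors hx ?_ hf hfF), fun v hv hv₀ => ?_⟩
    · intro a ha b hb hab
      exact hinj ha hb (by rwa [hψP a ha, hψP b hb] at hab)
    · by_cases hvP : v ∈ privateNeighbors G F x
      · have := hA v hvP
        rw [← hψP v hvP, hv₀] at this
        simp at this
      · exact hbad v (by simp [hv, hvP]) hv₀

/-- If some vertex has degree less than `d`, give that vertex a color that elsewhere is used only
on vertices of degree `d`. -/
theorem exists_distinguishing_of_degree_lt (hgirth : 5 ≤ G.girth) (hconn : G.Connected) {d : ℕ}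
    (hC : Fintype.card C = d + 1) (hdeg : ∀ v, G.degree v ≤ d) (c₀ : C) {r s : V}
    (hr : G.degree r < d) (hrs : G.Adj r s) :
    ∃ φ : V → C, IsProperDistinguishingColoring G φ := by
  have hrP : ∀ w, w ∈ privateNeighbors G {r} r ↔ G.Adj r w := by
    intro w
    simp only [mem_privateNeighbors, Finset.mem_singleton, and_iff_left_iff_imp]
    exact fun h => ⟨h.ne', fun u hu _ => hu⟩
  have hcard : (privateNeighbors G {r} r).card ≤ (({c₀} : Finset C)ᶜ).card := by
    rw [Finset.card_compl, hC, Finset.card_singleton, Nat.add_sub_cancel]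
    exact (Finset.card_le_card (Finset.filter_subset _ _)).trans
      ((G.card_neighborFinset_eq_degree r).trans_lt hr).le
  have hsP := (hrP s).2 hrs
  obtain ⟨c, hc⟩ : (({c₀} : Finset C)ᶜ).Nonempty :=
    Finset.card_pos.1 ((Finset.card_pos.2 ⟨s, hsP⟩).trans_le hcard)
  obtain ⟨φ, hφr, hφ, hA, hinj, -⟩ := exists_coloring_union_privateNeighbors hgirth
    (F := {r}) (φ := fun _ => c₀) (by
      intro u hu v hv huv
      rw [Finset.mem_singleton] at hu hv
      exact (huv.ne (hu.trans hv.symm)).elim) (by simp) hcard hsP hc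
  have hr₀ : φ r = c₀ := hφr r (by simp)
  obtain ⟨ψ, hψ, hprop, hfix, hbad⟩ := exists_distinguishing_extension hgirth hconn hC hdeg c₀
    ({r} ∪ privateNeighbors G {r} r) ⟨r, by simp⟩ (by
      intro v hv
      rcases Finset.mem_union.1 hv with hv | hv
      · rw [Finset.mem_singleton.1 hv]
        exact ⟨s, Finset.mem_union_right _ hsP, hrs⟩
      · exact ⟨r, by simp, ((hrP v).1 hv).symm⟩) φ hφ
  have hψP : ∀ v ∈ privateNeighbors G {r} r, ψ v = φ v := fun v hv =>
    hψ v (Finset.mem_union_right _ hv)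
  refine ⟨ψ, hprop, fun f hf => hfix f hf (fixes_privateNeighbors (by simp) ?_ hf ?_)⟩
  · intro a ha b hb hab
    exact hinj ha hb (by rwa [hψP a ha, hψP b hb] at hab)
  · intro v hv
    rw [Finset.mem_singleton.1 hv]
    have hfr : ψ (f r) = c₀ := by rw [hf, hψ r (by simp), hr₀]
    by_contra hne
    by_cases hmem : f r ∈ privateNeighbors G {r} r
    · have := hA _ hmem
      rw [← hψP _ hmem, hfr] at this
      simp at this
    · have := (hbad (f r) (by simp [hne, hmem]) hfr).2
      rw [f.degree_eq] at this
      omega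

/-- A neighborhood coloring in which exactly two prescribed neighbors of `r` share a color. -/
theorem exists_coloring_closedNeighborhood (hgirth : 5 ≤ G.girth) {d : ℕ}
    (hC : Fintype.card C = d + 1) (hdeg : ∀ v, G.degree v ≤ d) {c₀ c₁ c₂ : C} (h01 : c₀ ≠ c₁)
    (h02 : c₀ ≠ c₂) (h12 : c₁ ≠ c₂) {r s t : V} (hrs : G.Adj r s) (hrt : G.Adj r t)
    (hst : s ≠ t) :
    ∃ φ : V → C, ProperOn G φ (insert r (G.neighborFinset r)) ∧ φ r = c₀ ∧ φ s = c₁ ∧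
      φ t = c₁ ∧ (∀ u, G.Adj r u → φ u ≠ c₀ ∧ φ u ≠ c₂) ∧
      ∀ u v, G.Adj r u → G.Adj r v → u ≠ t → v ≠ t → φ u = φ v → u = v := by
  have hcard : ((G.neighborFinset r).erase t).card ≤ (({c₀, c₂} : Finset C)ᶜ).card := by
    rw [Finset.card_compl, hC, Finset.card_pair h02, Finset.card_erase_of_mem (by simpa using hrt),
      G.card_neighborFinset_eq_degree]
    have := hdeg r
    omega
  obtain ⟨g, hgA, hinj, hgs⟩ := exists_injOn_mapsTo_apply_eq hcard (y := s) (c := c₁)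
    (by simp [hst, hrs]) (by simp [h01.symm, h12])
  have hg : ∀ u, G.Adj r u → u ≠ t → g u ≠ c₀ ∧ g u ≠ c₂ := fun u hu hut => by
    simpa using hgA u (by simp [hu, hut])
  have hval : ∀ u, G.Adj r u → u ≠ t →
      (if u = r then c₀ else if u = t then c₁ else g u) = g u := fun u hu hut => by
    simp [hu.ne', hut]
  have hφ : ∀ u, G.Adj r u → (if u = r then c₀ else if u = t then c₁ else g u) ≠ c₀ ∧
      (if u = r then c₀ else if u = t then c₁ else g u) ≠ c₂ := by
    intro u hu
    by_cases hut : u = t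
    · subst hut
      simp [hu.ne', h01.symm, h12]
    · rw [hval u hu hut]
      exact hg u hu hut
  refine ⟨fun v => if v = r then c₀ else if v = t then c₁ else g v, ?_, by simp, ?_, ?_, hφ, ?_⟩
  · intro u hu v hv huv
    simp only [Finset.mem_insert, SimpleGraph.mem_neighborFinset] at hu hv
    rcases hu with rfl | hu
    · simpa using (hφ v huv).1.symm
    rcases hv with rfl | hv
    · simpa using (hφ u hu).1
    exact (not_triangle_of_five_le_girth hgirth hu huv hv.symm).elim
  · exact (hval s hrs hst).trans hgs
  · simp [hrt.ne']
  · intro u v hu hv hut hvt huv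
    beta_reduce at huv
    rw [hval u hu hut, hval v hv hvt] at huv
    exact hinj (by simp [hu, hut]) (by simp [hv, hvt]) huv

/-- In a regular graph, two neighbors `p₀`, `p₂` of `p₁` get the same color, which makes `p₁`
recognizable, and the colors of `p₃` and `p₄` tell `p₂` from `p₀`. -/
theorem exists_distinguishing_of_regular (hgirth : 5 ≤ G.girth) (hconn : G.Connected) {d : ℕ}
    (hC : Fintype.card C = d + 1) (hdeg : ∀ v, G.degree v = d) {c₀ c₁ c₂ : C} (h01 : c₀ ≠ c₁)
    (h02 : c₀ ≠ c₂) (h12 : c₁ ≠ c₂) {p₀ p₁ p₂ p₃ p₄ : V} (h₀₁ : G.Adj p₀ p₁)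
    (h₁₂ : G.Adj p₁ p₂) (h₂₃ : G.Adj p₂ p₃) (h₃₄ : G.Adj p₃ p₄) (hdist : 4 ≤ G.dist p₀ p₄) :
    ∃ φ : V → C, IsProperDistinguishingColoring G φ := by
  have hstep : ∀ {a b : V} (c : V), G.Adj a b → G.dist a c ≤ G.dist b c + 1 := by
    intro a b c hab
    have h1 := hconn.dist_triangle (u := a) (v := b) (w := c)
    rw [SimpleGraph.dist_eq_one_iff_adj.2 hab] at h1
    omega
  have hadj_dist : ∀ {a b : V}, G.Adj a b → G.dist a b = 1 := SimpleGraph.dist_eq_one_iff_adj.2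
  have hself : ∀ a : V, G.dist a a = 0 := fun a => SimpleGraph.dist_self
  have hd1 : 3 ≤ G.dist p₁ p₄ := by have := hstep p₄ h₀₁; omega
  have hd2 : 2 ≤ G.dist p₂ p₄ := by have := hstep p₄ h₁₂; omega
  have hd34 : G.dist p₃ p₄ = 1 := hadj_dist h₃₄
  have hd03 : 3 ≤ G.dist p₀ p₃ := by
    have := hconn.dist_triangle (u := p₀) (v := p₃) (w := p₄)
    omega
  have hd13 : 2 ≤ G.dist p₁ p₃ := by have := hstep p₃ h₀₁; omega
  have h02ne : p₀ ≠ p₂ := by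
    intro h
    have := hstep p₄ h₂₃
    rw [h] at hdist
    omega
  obtain ⟨φ₁, hφ₁, hr, hs, ht, hN, hNinj⟩ := exists_coloring_closedNeighborhood hgirth hC
    (fun v => (hdeg v).le) h01 h02 h12 h₀₁.symm h₁₂ h02ne
  have hpair : ∀ {x u : V} {F : Finset V}, u ∈ F → G.Adj x u → ∀ {A : Finset C}, A.card ≤ 2 →
      (privateNeighbors G F x).card ≤ (Aᶜ).card := by
    intro x u F hu hxu A hA
    have := card_privateNeighbors_lt hu hxu
    rw [hdeg] at this
    rw [Finset.card_compl, hC]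
    omega
  set F₁ := insert p₁ (G.neighborFinset p₁) with hF₁
  have hmemF₁ : ∀ v, v ∈ F₁ ↔ v = p₁ ∨ G.Adj p₁ v := by simp [hF₁]
  -- the other neighbors of `p₀`
  set P₂ := privateNeighbors G F₁ p₀ with hP₂
  have hmemP₂ : ∀ v, v ∈ P₂ ↔ G.Adj p₀ v ∧ v ≠ p₁ := by
    intro v
    rw [hP₂, mem_privateNeighbors]
    refine and_congr_right fun hv => ⟨fun h e => h.1 ((hmemF₁ v).2 (Or.inl e)), fun h => ⟨?_, ?_⟩⟩
    · rw [hmemF₁]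
      rintro (e | e)
      · exact h e
      · exact not_triangle_of_five_le_girth hgirth hv e.symm h₀₁.symm
    · intro u hu hvu
      rcases (hmemF₁ u).1 hu with rfl | hu
      · exact (not_triangle_of_five_le_girth hgirth hv hvu h₀₁.symm).elim
      · exact eq_of_common_neighbors_of_five_le_girth hgirth h hvu hu hv.symm h₀₁.symm
  have hcard₂ : P₂.card ≤ (({c₀, c₁} : Finset C)ᶜ).card :=
    hpair (u := p₁) (by simp [hF₁]) h₀₁ Finset.card_le_two
  obtain ⟨φ₂, hφ₂F, hφ₂, hA₂, hinj₂⟩ : ∃ φ₂ : V → C, (∀ v ∈ F₁, φ₂ v = φ₁ v) ∧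
      ProperOn G φ₂ (F₁ ∪ P₂) ∧ (∀ v ∈ P₂, φ₂ v ≠ c₀) ∧ Set.InjOn φ₂ P₂ := by
    by_cases hemp : P₂ = ∅
    · exact ⟨φ₁, fun _ _ => rfl, by simpa [hemp] using hφ₁, by simp [hemp], by simp [hemp]⟩
    · obtain ⟨w, hw⟩ := Finset.nonempty_iff_ne_empty.2 hemp
      obtain ⟨c, hc⟩ := Finset.card_pos.1 ((Finset.card_pos.2 ⟨w, hw⟩).trans_le hcard₂)
      obtain ⟨φ₂, h1, h2, h3, h4, -⟩ := exists_coloring_union_privateNeighbors hgirth hφ₁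
        (by simp [hs]) hcard₂ hw hc
      refine ⟨φ₂, h1, h2, fun v hv e => ?_, h4⟩
      simpa [e] using h3 v hv
  set F₂ := F₁ ∪ P₂ with hF₂
  have hmemF₂ : ∀ v, v ∈ F₂ → v = p₁ ∨ G.Adj p₁ v ∨ G.Adj p₀ v := by
    intro v hv
    rcases Finset.mem_union.1 hv with hv | hv
    · have := (hmemF₁ v).1 hv
      tauto
    · exact Or.inr (Or.inr ((hmemP₂ v).1 hv).1)
  have hp₁F₂ : p₁ ∈ F₂ := by simp [hF₂, hF₁]
  have hp₀F₂ : p₀ ∈ F₂ := by simp [hF₂, hF₁, h₀₁.symm]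
  have hp₂F₂ : p₂ ∈ F₂ := by simp [hF₂, hF₁, h₁₂]
  -- the private neighbors of `p₂`, among them `p₃`
  set P₃ := privateNeighbors G F₂ p₂ with hP₃
  have hp₃ : p₃ ∈ P₃ := by
    refine mem_privateNeighbors.2 ⟨h₂₃, fun h => ?_, fun u hu hadj => ?_⟩
    · rcases hmemF₂ _ h with e | e | e
      · rw [e, hself] at hd13
        omega
      · have := hadj_dist e
        omega
      · have := hadj_dist e
        omega
    · have h1 := hadj_dist hadj.symm
      rcases hmemF₂ _ hu with rfl | e | e
      · omega
      · have : p₁ ≠ p₃ := by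
          rintro rfl
          rw [hself] at hd13
          omega
        exact eq_of_common_neighbors_of_five_le_girth hgirth this e hadj h₁₂ h₂₃.symm
      · have := hstep p₃ e
        omega
  obtain ⟨φ₃, hφ₃F, hφ₃, hA₃, hinj₃, hy⟩ := exists_coloring_union_privateNeighbors hgirth hφ₂
    (x := p₂) (A := ({c₁} : Finset C)ᶜ)
    (by simp [hφ₂F p₂ (by simp [hF₁, h₁₂]), ht])
    (hpair (u := p₁) hp₁F₂ h₁₂.symm (by simp)) hp₃ (c := c₀) (by simp [h01])
  rw [← hP₃] at hφ₃ hA₃ hinj₃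
  set F₃ := F₂ ∪ P₃ with hF₃
  have hmemF₃ : ∀ v, v ∈ F₃ → v = p₁ ∨ G.Adj p₁ v ∨ G.Adj p₀ v ∨ G.Adj p₂ v := by
    intro v hv
    rcases Finset.mem_union.1 hv with hv | hv
    · have := hmemF₂ v hv
      tauto
    · have := (mem_privateNeighbors.1 hv).1
      tauto
  have hp₂F₃ : p₂ ∈ F₃ := Finset.mem_union_left _ hp₂F₂
  have hp₃F₃ : p₃ ∈ F₃ := Finset.mem_union_right _ hp₃
  -- the private neighbors of `p₃`, among them `p₄`
  set P₄ := privateNeighbors G F₃ p₃ with hP₄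
  have hp₄ : p₄ ∈ P₄ := by
    refine mem_privateNeighbors.2 ⟨h₃₄, fun h => ?_, fun u hu hadj => ?_⟩
    · rcases hmemF₃ _ h with e | e | e | e
      · rw [e, hself] at hd1
        omega
      · have := hadj_dist e
        omega
      · have := hadj_dist e
        omega
      · have := hadj_dist e
        omega
    · have h1 := hadj_dist hadj.symm
      rcases hmemF₃ _ hu with rfl | e | e | e
      · omega
      · have := hstep p₄ e
        omega
      · have := hstep p₄ e
        omega
      · have : p₂ ≠ p₄ := by
          rintro rfl
          rw [hself] at hd2
          omega
        exact eq_of_common_neighbors_of_five_le_girth hgirth this e hadj h₂₃ h₃₄.symm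
  obtain ⟨φ₄, hφ₄F, hφ₄, hA₄, hinj₄, hz⟩ := exists_coloring_union_privateNeighbors hgirth hφ₃
    (x := p₃) (A := ({c₀} : Finset C)ᶜ) (by simp [hy])
    (hpair (u := p₂) hp₂F₃ h₂₃.symm (by simp)) hp₄ (c := c₂) (by simp [h02.symm])
  rw [← hP₄] at hφ₄ hA₄ hinj₄
  set F₄ := F₃ ∪ P₄ with hF₄
  obtain ⟨ψ, hψ, hprop, hfix, hbad⟩ := exists_distinguishing_extension hgirth hconn hC
    (fun v => (hdeg v).le) c₀ F₄ ⟨p₃, Finset.mem_union_left _ hp₃F₃⟩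
    (exists_adj_union_privateNeighbors hp₃F₃ <| exists_adj_union_privateNeighbors hp₂F₂ <|
      exists_adj_union_privateNeighbors ((hmemF₁ p₀).2 (Or.inr h₀₁.symm)) <| by
        intro v hv
        rcases (hmemF₁ v).1 hv with rfl | hv
        · exact ⟨p₂, (hmemF₁ p₂).2 (Or.inr h₁₂), h₁₂⟩
        · exact ⟨p₁, (hmemF₁ p₁).2 (Or.inl rfl), hv.symm⟩) φ₄ hφ₄
  have hψ₄ : ∀ v ∈ P₄, ψ v = φ₄ v := fun v hv => hψ v (Finset.mem_union_right _ hv)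
  have hψF₃ : ∀ v ∈ F₃, ψ v = φ₃ v := fun v hv =>
    (hψ v (Finset.mem_union_left _ hv)).trans (hφ₄F v hv)
  have hψ₃ : ∀ v ∈ P₃, ψ v = φ₃ v := fun v hv => hψF₃ v (Finset.mem_union_right _ hv)
  have hψF₂ : ∀ v ∈ F₂, ψ v = φ₂ v := fun v hv =>
    (hψF₃ v (Finset.mem_union_left _ hv)).trans (hφ₃F v hv)
  have hψ₂ : ∀ v ∈ P₂, ψ v = φ₂ v := fun v hv => hψF₂ v (Finset.mem_union_right _ hv)
  have hψF₁ : ∀ v ∈ F₁, ψ v = φ₁ v := fun v hv =>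
    (hψF₂ v (Finset.mem_union_left _ hv)).trans (hφ₂F v hv)
  have hψN : ∀ v, G.Adj p₁ v → ψ v = φ₁ v := fun v hv => hψF₁ v ((hmemF₁ v).2 (Or.inr hv))
  have hψp₀ : ψ p₀ = c₁ := (hψN p₀ h₀₁.symm).trans hs
  have hψp₁ : ψ p₁ = c₀ := (hψF₁ p₁ ((hmemF₁ p₁).2 (Or.inl rfl))).trans hr
  have hψp₂ : ψ p₂ = c₁ := (hψN p₂ h₁₂).trans ht
  have hψp₃ : ψ p₃ = c₀ := (hψF₃ p₃ hp₃F₃).trans hy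
  have hψp₄ : ψ p₄ = c₂ := (hψ₄ p₄ hp₄).trans hz
  have hzero : ∀ v ∈ F₄, ψ v = c₀ → v = p₁ ∨ v = p₃ := by
    intro v hv hv₀
    rcases Finset.mem_union.1 hv with hv | hv
    · rcases Finset.mem_union.1 hv with hv | hv
      · rcases Finset.mem_union.1 hv with hv | hv
        · refine ((hmemF₁ v).1 hv).imp_right fun h => ?_
          exact ((hN v h).1 ((hψN v h).symm.trans hv₀)).elim
        · exact (hA₂ v hv ((hψ₂ v hv).symm.trans hv₀)).elim
      · exact Or.inr (hinj₃ hv hp₃ (((hψ₃ v hv).symm.trans hv₀).trans hy.symm))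
    · have := hA₄ v hv
      rw [← hψ₄ v hv, hv₀] at this
      simp at this
  refine ⟨ψ, hprop, fun f hf => hfix f hf ?_⟩
  have hfadj : ∀ {a b : V}, G.Adj a b → G.Adj (f a) (f b) := fun h => f.map_adj_iff.2 h
  have hfp₁ : f p₁ = p₁ := by
    have h0 : ψ (f p₁) = c₀ := by rw [hf, hψp₁]
    by_cases hmem : f p₁ ∈ F₄
    · rcases hzero _ hmem h0 with h | h
      · exact h
      · obtain ⟨w, hw⟩ := f.surjective p₄
        have hadj : G.Adj p₁ w := f.map_adj_iff.1 (by rw [h, hw]; exact h₃₄)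
        have : ψ w = c₂ := by rw [← hf, hw, hψp₄]
        exact ((hN w hadj).2 ((hψN w hadj).symm.trans this)).elim
    · refine (h02ne (f.injective ((hbad _ hmem h0).1 ?_ ?_ ?_))).elim
      · simpa using hfadj h₀₁.symm
      · simpa using hfadj h₁₂
      · rw [hf, hf, hψp₀, hψp₂]
  have hfN : ∀ {v : V}, G.Adj p₁ v → G.Adj p₁ (f v) := fun h => by
    have := hfadj h
    rwa [hfp₁] at this
  have hNinj' : ∀ u v, G.Adj p₁ u → G.Adj p₁ v → u ≠ p₂ → v ≠ p₂ → ψ u = ψ v → u = v := by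
    intro u v hu hv hu2 hv2 huv
    exact hNinj u v hu hv hu2 hv2 (by rwa [hψN u hu, hψN v hv] at huv)
  have hfp₀ : f p₀ = p₀ := by
    refine hNinj' _ _ (hfN h₀₁.symm) h₀₁.symm (fun h => ?_) h02ne (hf _)
    obtain ⟨w, hw⟩ := f.surjective p₃
    have hadj : G.Adj p₀ w := f.map_adj_iff.1 (by rw [h, hw]; exact h₂₃)
    have hw₀ : ψ w = c₀ := by rw [← hf, hw, hψp₃]
    by_cases hwp : w = p₁
    · rw [hwp, hfp₁] at hw
      rw [hw, hself] at hd13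
      omega
    · have hwP := (hmemP₂ w).2 ⟨hadj, hwp⟩
      exact hA₂ w hwP ((hψ₂ w hwP).symm.trans hw₀)
  have hfp₂ : f p₂ = p₂ := by
    by_contra h
    refine h02ne (f.injective (hfp₀.trans ?_))
    exact hNinj' _ _ h₀₁.symm (hfN h₁₂) h02ne h (by rw [hf, hψp₀, hψp₂])
  refine fixes_privateNeighbors hp₃F₃ ?_ hf <| fixes_privateNeighbors hp₂F₂ ?_ hf <|
    fixes_privateNeighbors ((hmemF₁ p₀).2 (Or.inr h₀₁.symm)) ?_ hf fun v hv => ?_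
  · exact hinj₄.congr fun v hv => (hψ₄ v hv).symm
  · exact hinj₃.congr fun v hv => (hψ₃ v hv).symm
  · exact hinj₂.congr fun v hv => (hψ₂ v hv).symm
  · rcases (hmemF₁ v).1 hv with rfl | hv
    · exact hfp₁
    · by_cases hv2 : v = p₂
      · rw [hv2, hfp₂]
      · refine hNinj' _ _ (hfN hv) hv (fun h => hv2 (f.injective (h.trans hfp₂.symm))) hv2 (hf v)

end

/-- If `G` is connected with girth at least 5 and has diameter at least 4 (some two
vertices at distance at least 4), then `χ_D(G) ≤ Δ(G) + 1`. -/
theorem chiD_le_maxDegree_add_one_of_diam_ge_four {V : Type*} [Fintype V] [DecidableEq V]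
    (G : SimpleGraph V) [DecidableRel G.Adj]
    (hconn : G.Connected) (hgirth : 5 ≤ G.girth)
    (hdiam : ∃ u v : V, 4 ≤ G.dist u v) :
    ∃ φ : V → Fin (G.maxDegree + 1), IsProperDistinguishingColoring G φ := by
  obtain ⟨u, v, huv⟩ := hdiam
  obtain ⟨p, hp⟩ := hconn.exists_walk_length_eq_dist u v
  have hadj : ∀ i < 4, G.Adj (p.getVert i) (p.getVert (i + 1)) := fun i hi =>
    p.adj_getVert_succ (by omega)
  have hcard : Fintype.card (Fin (G.maxDegree + 1)) = G.maxDegree + 1 := Fintype.card_fin _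
  have hle : ∀ w, G.degree w ≤ G.maxDegree := fun w => G.degree_le_maxDegree w
  by_cases hreg : ∀ w, G.degree w = G.maxDegree
  · have hdist : 4 ≤ G.dist (p.getVert 0) (p.getVert 4) := by
      have h1 := hconn.dist_triangle (u := u) (v := p.getVert 4) (w := v)
      have h2 := SimpleGraph.dist_le (p.drop 4)
      rw [p.drop_length] at h2
      rw [p.getVert_zero]
      omega
    have h02 : p.getVert 0 ≠ p.getVert 2 := by
      intro h
      have h1 := hconn.dist_triangle (u := p.getVert 2) (v := p.getVert 3) (w := p.getVert 4)
      rw [SimpleGraph.dist_eq_one_iff_adj.2 (hadj 2 (by omega)),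
        SimpleGraph.dist_eq_one_iff_adj.2 (hadj 3 (by omega)), ← h] at h1
      omega
    have hΔ : 2 ≤ G.maxDegree := by
      refine le_trans ?_ (hle (p.getVert 1))
      rw [← G.card_neighborFinset_eq_degree, ← Finset.card_pair h02]
      refine Finset.card_le_card fun w hw => ?_
      rcases Finset.mem_insert.1 hw with rfl | hw
      · simpa using (hadj 0 (by omega)).symm
      · rw [Finset.mem_singleton.1 hw]
        simpa using hadj 1 (by omega)
    exact exists_distinguishing_of_regular hgirth hconn hcard hreg
      (c₀ := ⟨0, by omega⟩) (c₁ := ⟨1, by omega⟩) (c₂ := ⟨2, by omega⟩)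
      (by simp) (by simp) (by simp) (hadj 0 (by omega)) (hadj 1 (by omega)) (hadj 2 (by omega))
      (hadj 3 (by omega)) hdist
  · push Not at hreg
    obtain ⟨r, hr⟩ := hreg
    have hnt : Nontrivial V := ⟨_, _, (hadj 0 (by omega)).ne⟩
    obtain ⟨s, hrs⟩ := hconn.preconnected.exists_adj_of_nontrivial r
    exact exists_distinguishing_of_degree_lt hgirth hconn hcard hle 0
      (lt_of_le_of_ne (hle r) hr) hrs
end

section
/- Let G be a connected finite simple graph with girth at least 5 and maximum degree Δ. If there exists a vertex w and two neighbors x_1, y_1 of w such that no automorphism of G maps x_1 to y_1, then χ_D(G) ≤ Δ + 1. -/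
namespace SimpleGraph

open Finset

variable {V : Type*} {G : SimpleGraph V}

lemma not_adj_of_five_le_girth (hgirth : 5 ≤ G.girth) {a b c : V} (hab : G.Adj a b)
    (hac : G.Adj a c) : ¬ G.Adj b c := by
  intro hbc
  have hcycle : (Walk.cons hab (.cons hbc (.cons hac.symm .nil))).IsCycle := by
    simp [Walk.cons_isCycle_iff, hab.ne, hab.ne', hac.ne, hac.ne', hbc.ne]
  have := hcycle.girth_le_length
  simp at this
  omega

lemma eq_of_five_le_girth (hgirth : 5 ≤ G.girth) {p q u v : V} (hpq : p ≠ q)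
    (hpu : G.Adj p u) (hpv : G.Adj p v) (hqu : G.Adj q u) (hqv : G.Adj q v) : u = v := by
  by_contra huv
  have hcycle : (Walk.cons hpu (.cons hqu.symm (.cons hqv (.cons hpv.symm .nil)))).IsCycle := by
    simp [Walk.cons_isCycle_iff, hpu.ne, hpu.ne', hqu.ne', hpv.ne, hpv.ne', hqv.ne, hpq,
      hpq.symm, huv]
  have := hcycle.girth_le_length
  simp at this
  omega

lemma Connected.exists_adj_notMem_of_ne_univ [Fintype V] (hconn : G.Connected) {S : Finset V}
    {w : V} (hw : w ∈ S) (hS : S ≠ univ) : ∃ p ∈ S, ∃ v ∉ S, G.Adj p v := by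
  obtain ⟨z, hz⟩ : ∃ z, z ∉ S := by
    by_contra! h
    exact hS (eq_univ_of_forall h)
  obtain ⟨P⟩ := hconn.preconnected w z
  obtain ⟨d, -, hd, hd'⟩ := P.exists_boundary_dart (S : Set V) (by simpa) (by simpa)
  exact ⟨d.fst, by simpa using hd, d.snd, by simpa using hd', d.adj⟩

lemma exists_injOn_forall_mem {α : Type*} [Nonempty α] {s : Finset V} {t : Finset α}
    (h : s.card ≤ t.card) : ∃ f : V → α, Set.InjOn f s ∧ ∀ v ∈ s, f v ∈ t := by
  obtain ⟨f, hf, hinj⟩ := (Set.toFinite (s : Set V)).exists_injOn_of_encard_le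
    (t := (t : Set α)) (by simpa using h)
  exact ⟨f, hinj, fun v hv => by simpa using hf hv⟩

variable [Fintype V] [DecidableRel G.Adj]

/-- Prefer a nonzero color; the color `0` is free when it is forced, by counting. -/
lemma exists_free_color (φ : V → Fin (G.maxDegree + 1)) (S : Finset V) (v : V) :
    ∃ c, (∀ u ∈ S, G.Adj v u → φ u ≠ c) ∧
      (c = 0 → ∀ c' ≠ 0, ∃ u ∈ S, G.Adj v u ∧ φ u = c') := by
  by_cases h : ∀ c' ≠ 0, ∃ u ∈ S, G.Adj v u ∧ φ u = c'
  · refine ⟨0, fun u hu hvu hu0 => ?_, fun _ => h⟩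
    have hsub : univ ⊆ (G.neighborFinset v).image φ := by
      intro c _
      rw [mem_image]
      by_cases hc : c = 0
      · exact ⟨u, by simpa using hvu, by rw [hu0, hc]⟩
      · obtain ⟨u, -, hu, rfl⟩ := h c hc
        exact ⟨u, by simpa using hu, rfl⟩
    have h1 := (card_le_card hsub).trans card_image_le
    rw [card_fin, card_neighborFinset_eq_degree] at h1
    have := G.degree_le_maxDegree v
    omega
  · push Not at h
    obtain ⟨c, hc, h⟩ := h
    exact ⟨c, h, fun h0 => absurd h0 hc⟩

lemma injOn_neighborFinset_of_sees_all {φ : V → Fin (G.maxDegree + 1)} {v : V}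
    (h : ∀ c ≠ 0, ∃ u, G.Adj v u ∧ φ u = c) : Set.InjOn φ (G.neighborFinset v) := by
  refine card_image_iff.1 (le_antisymm card_image_le ?_)
  have hsub : univ.erase 0 ⊆ (G.neighborFinset v).image φ := by
    intro c hc
    obtain ⟨u, hu, rfl⟩ := h c (ne_of_mem_erase hc)
    exact mem_image_of_mem _ (by simpa using hu)
  have h1 := card_le_card hsub
  rw [card_erase_of_mem (mem_univ _), card_fin] at h1
  rw [card_neighborFinset_eq_degree]
  have := G.degree_le_maxDegree v
  omega

/-- A coloring `φ`, meaningful on the set `S`, which is proper on `S`, is distinguishing on `S`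
for automorphisms fixing `w`, and uses the color `0` away from `w` only at vertices that see
all other colors. -/
structure IsRootedColoring (G : SimpleGraph V) [DecidableRel G.Adj] (w : V) (S : Finset V)
    (φ : V → Fin (G.maxDegree + 1)) : Prop where
  neighborFinset_subset : G.neighborFinset w ⊆ S
  exists_adj : ∀ v ∈ S, ∃ u ∈ S, G.Adj v u
  proper : ∀ u ∈ S, ∀ v ∈ S, G.Adj u v → φ u ≠ φ v
  sees_all : ∀ v ∈ S, v ≠ w → φ v = 0 → ∀ c ≠ 0, ∃ u ∈ S, G.Adj v u ∧ φ u = c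
  fixes : ∀ f : G ≃g G, f w = w → (∀ v ∈ S, f v ∈ S → φ (f v) = φ v) → ∀ v ∈ S, f v = v

variable [DecidableEq V]

lemma exists_isRootedColoring_base (hgirth : 5 ≤ G.girth) {w x y : V} (hx : G.Adj w x)
    (hy : G.Adj w y) (hno : ∀ f : G ≃g G, f x ≠ y) :
    ∃ φ, IsRootedColoring G w (insert w (G.neighborFinset w)) φ ∧ φ w = 0 ∧ φ x = φ y := by
  have hxy : x ≠ y := hno (RelIso.refl _)
  obtain ⟨ψ, hψ, hψ0⟩ := exists_injOn_forall_mem (s := G.neighborFinset w)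
    (t := (univ : Finset (Fin (G.maxDegree + 1))).erase 0) (by
      rw [card_erase_of_mem (mem_univ _), card_fin, card_neighborFinset_eq_degree]
      exact G.degree_le_maxDegree w)
  simp only [mem_neighborFinset, mem_erase, mem_univ, and_true] at hψ0
  let φ : V → Fin (G.maxDegree + 1) := fun v => if v = w then 0 else ψ (if v = y then x else v)
  have hφw : φ w = 0 := by simp [φ]
  have hφ : ∀ v, G.Adj w v → φ v = ψ (if v = y then x else v) := fun v hv => by
    simp [φ, hv.ne']
  have hφ0 : ∀ v, G.Adj w v → φ v ≠ 0 := fun v hv => by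
    rw [hφ v hv]
    exact hψ0 _ (by split_ifs <;> assumption)
  refine ⟨φ, ⟨subset_insert _ _, ?_, ?_, ?_, ?_⟩, hφw, by simp [hφ, hx, hy]⟩
  · intro v hv
    rw [mem_insert, mem_neighborFinset] at hv
    rcases hv with rfl | hv
    · exact ⟨x, by simp [hx], hx⟩
    · exact ⟨w, by simp, hv.symm⟩
  · intro u hu v hv huv
    rw [mem_insert, mem_neighborFinset] at hu hv
    rcases hu with rfl | hu
    · rw [hφw]
      exact (hφ0 v huv).symm
    · rcases hv with rfl | hv
      · rw [hφw]
        exact hφ0 u hu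
      · exact absurd huv (not_adj_of_five_le_girth hgirth hu hv)
  · intro v hv hvw h0
    rw [mem_insert, mem_neighborFinset] at hv
    exact absurd h0 (hφ0 v (hv.resolve_left hvw))
  · intro f hfw hf v hv
    have hmem := hv
    rw [mem_insert, mem_neighborFinset] at hv
    rcases hv with rfl | hv
    · exact hfw
    have hfv : G.Adj w (f v) := by
      rw [← hfw]
      exact f.map_adj_iff.2 hv
    have h := hf v hmem (by simp [hfv])
    rw [hφ _ hv, hφ _ hfv] at h
    have h' := hψ (by simp only [coe_neighborFinset, mem_neighborSet]; split_ifs <;> assumption)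
      (by simp only [coe_neighborFinset, mem_neighborSet]; split_ifs <;> assumption) h
    by_cases hvy : v = y
    · by_cases hfvy : f v = y
      · rw [hfvy, hvy]
      · rw [if_neg hfvy, if_pos hvy] at h'
        exact absurd (by rw [← h', RelIso.symm_apply_apply, hvy]) (hno f.symm)
    · rw [if_neg hvy] at h'
      by_cases hfvy : f v = y
      · rw [if_pos hfvy] at h'
        exact absurd (h' ▸ hfvy) (hno f)
      · rwa [if_neg hfvy] at h'

lemma IsRootedColoring.exists_extension (hgirth : 5 ≤ G.girth) {w p : V} {S : Finset V}
    {φ : V → Fin (G.maxDegree + 1)} (h : IsRootedColoring G w S φ) (hp : p ∈ S) :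
    ∃ φ', IsRootedColoring G w (S ∪ G.neighborFinset p) φ' ∧ ∀ v ∈ S, φ' v = φ v := by
  let B := {v ∈ G.neighborFinset p \ S | ∀ q ∈ S, G.Adj v q → q = p}
  have hB : ∀ v, v ∈ B ↔ (G.Adj p v ∧ v ∉ S) ∧ ∀ q ∈ S, G.Adj v q → q = p := by simp [B]
  have hcard : B.card ≤ (({0, φ p}ᶜ : Finset (Fin (G.maxDegree + 1)))).card := by
    obtain ⟨u, hu, hpu⟩ := h.exists_adj p hp
    have hlt : B.card < (G.neighborFinset p).card :=
      card_lt_card ⟨fun v hv => by simpa using ((hB v).1 hv).1.1,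
        fun hsub => ((hB u).1 (hsub (by simpa using hpu))).1.2 hu⟩
    rw [card_neighborFinset_eq_degree] at hlt
    have := G.degree_le_maxDegree p
    have := card_le_two (a := (0 : Fin (G.maxDegree + 1))) (b := φ p)
    rw [card_compl, Fintype.card_fin]
    omega
  obtain ⟨ψ, hψ, hψmem⟩ := exists_injOn_forall_mem hcard
  simp only [mem_compl, mem_insert, mem_singleton, not_or] at hψmem
  choose γ hγ hγ0 using exists_free_color φ S
  let φ' : V → Fin (G.maxDegree + 1) := fun v => if v ∈ S then φ v else if v ∈ B then ψ v else γ v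
  have hφS : ∀ v ∈ S, φ' v = φ v := fun v hv => by simp [φ', hv]
  have hφB : ∀ v ∈ B, φ' v = ψ v := fun v hv => by simp [φ', hv, ((hB v).1 hv).1.2]
  have hφγ : ∀ v ∉ S, v ∉ B → φ' v = γ v := fun v hv hv' => by simp [φ', hv, hv']
  have hfree : ∀ v ∉ S, ∀ u ∈ S, G.Adj v u → φ' v ≠ φ u := by
    intro v hv u hu hvu
    by_cases hvB : v ∈ B
    · rw [hφB v hvB, ((hB v).1 hvB).2 u hu hvu]
      exact (hψmem v hvB).2
    · rw [hφγ v hv hvB]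
      exact (hγ v u hu hvu).symm
  have hmem : ∀ v, v ∈ S ∪ G.neighborFinset p ↔ v ∈ S ∨ G.Adj p v := by simp
  refine ⟨φ', ⟨h.neighborFinset_subset.trans subset_union_left, ?_, ?_, ?_, ?_⟩, hφS⟩
  · intro v hv
    rcases (hmem v).1 hv with hv | hv
    · obtain ⟨u, hu, hvu⟩ := h.exists_adj v hv
      exact ⟨u, mem_union_left _ hu, hvu⟩
    · exact ⟨p, mem_union_left _ hp, hv.symm⟩
  · intro u hu v hv huv
    by_cases huS : u ∈ S <;> by_cases hvS : v ∈ S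
    · rw [hφS u huS, hφS v hvS]
      exact h.proper u huS v hvS huv
    · rw [hφS u huS]
      exact (hfree v hvS u huS huv.symm).symm
    · rw [hφS v hvS]
      exact hfree u huS v hvS huv
    · exact absurd huv (not_adj_of_five_le_girth hgirth (((hmem u).1 hu).resolve_left huS)
        (((hmem v).1 hv).resolve_left hvS))
  · intro v hv hvw hv0 c hc
    suffices ∃ u ∈ S, G.Adj v u ∧ φ u = c by
      obtain ⟨u, hu, hvu, huc⟩ := this
      exact ⟨u, mem_union_left _ hu, hvu, by rw [hφS u hu, huc]⟩
    by_cases hvS : v ∈ S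
    · exact h.sees_all v hvS hvw (by rw [← hφS v hvS, hv0]) c hc
    · by_cases hvB : v ∈ B
      · exact absurd (by rw [← hφB v hvB, hv0]) (hψmem v hvB).1
      · exact hγ0 v (by rw [← hφγ v hvS hvB, hv0]) c hc
  · intro f hfw hf v hv
    have hfix : ∀ v ∈ S, f v = v := h.fixes f hfw fun v hv hfv => by
      rw [← hφS v hv, ← hφS _ hfv]
      exact hf v (mem_union_left _ hv) (mem_union_left _ hfv)
    by_cases hvS : v ∈ S
    · exact hfix v hvS
    have hpv := ((hmem v).1 hv).resolve_left hvS
    have hadj : ∀ q ∈ S, G.Adj (f v) q ↔ G.Adj v q := fun q hq => by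
      conv_lhs => rw [← hfix q hq]
      exact f.map_adj_iff
    have hpfv : G.Adj p (f v) := ((hadj p hp).2 hpv.symm).symm
    have hfvS : f v ∉ S := fun hfv => hvS (by rwa [← f.injective (hfix _ hfv)])
    by_cases hvB : v ∈ B
    · have hfvB : f v ∈ B := (hB _).2 ⟨⟨hpfv, hfvS⟩, fun q hq hq' =>
        ((hB v).1 hvB).2 q hq ((hadj q hq).1 hq')⟩
      refine hψ hfvB hvB ?_
      rw [← hφB _ hfvB, ← hφB _ hvB]
      exact hf v hv ((hmem _).2 (Or.inr hpfv))
    · obtain ⟨q, hq, hvq, hqp⟩ : ∃ q ∈ S, G.Adj v q ∧ q ≠ p := by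
        by_contra! hcon
        exact hvB ((hB v).2 ⟨⟨hpv, hvS⟩, hcon⟩)
      exact eq_of_five_le_girth hgirth hqp ((hadj q hq).2 hvq).symm hvq.symm hpfv hpv

lemma exists_isRootedColoring_univ (hconn : G.Connected) (hgirth : 5 ≤ G.girth) {w x y : V}
    (hx : G.Adj w x) (hy : G.Adj w y) (hno : ∀ f : G ≃g G, f x ≠ y) :
    ∃ φ, IsRootedColoring G w univ φ ∧ φ w = 0 ∧ φ x = φ y := by
  obtain ⟨φ₀, hφ₀, h₀, hxy₀⟩ := exists_isRootedColoring_base hgirth hx hy hno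
  obtain ⟨S, ⟨φ, hφ, hwS, hw0, hxy⟩, hmax⟩ := (Set.toFinite {S : Finset V |
    ∃ φ, IsRootedColoring G w S φ ∧ w ∈ S ∧ φ w = 0 ∧ φ x = φ y}).exists_maximal
      ⟨_, φ₀, hφ₀, mem_insert_self _ _, h₀, hxy₀⟩
  obtain rfl | hS := eq_or_ne S univ
  · exact ⟨φ, hφ, hw0, hxy⟩
  obtain ⟨p, hp, v, hv, hpv⟩ := hconn.exists_adj_notMem_of_ne_univ hwS hS
  obtain ⟨φ', hφ', heq⟩ := hφ.exists_extension hgirth hp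
  have hxS : x ∈ S := hφ.neighborFinset_subset (by simpa using hx)
  have hyS : y ∈ S := hφ.neighborFinset_subset (by simpa using hy)
  have hle := hmax ⟨φ', hφ', mem_union_left _ hwS, by rw [heq w hwS, hw0],
    by rw [heq x hxS, heq y hyS, hxy]⟩ subset_union_left
  exact absurd (hle (mem_union_right _ (by simpa using hpv))) hv

end SimpleGraph

/-- If `G` is connected with girth at least 5 and some vertex `w` has two neighbors
`x₁`, `y₁` such that no automorphism of `G` maps `x₁` to `y₁`, then `χ_D(G) ≤ Δ(G) + 1`. -/
theorem chiD_le_maxDegree_add_one_of_asymmetric_neighbors {V : Type*} [Fintype V]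
    [DecidableEq V] (G : SimpleGraph V) [DecidableRel G.Adj]
    (hconn : G.Connected) (hgirth : 5 ≤ G.girth)
    (w x₁ y₁ : V) (hx : G.Adj w x₁) (hy : G.Adj w y₁)
    (hno : ∀ f : G ≃g G, f x₁ ≠ y₁) :
    ∃ φ : V → Fin (G.maxDegree + 1), IsProperDistinguishingColoring G φ := by
  obtain ⟨φ, hφ, hw0, hxy⟩ := SimpleGraph.exists_isRootedColoring_univ hconn hgirth hx hy hno
  refine ⟨φ, fun u v => hφ.proper u (Finset.mem_univ u) v (Finset.mem_univ v), fun f hf v =>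
    hφ.fixes f ?_ (fun v _ _ => hf v) v (Finset.mem_univ v)⟩
  by_contra hfw
  have hinj := SimpleGraph.injOn_neighborFinset_of_sees_all (v := f w) fun c hc => by
    simpa using hφ.sees_all (f w) (Finset.mem_univ _) hfw (by rw [hf, hw0]) c hc
  have hfxy : f x₁ = f y₁ := hinj (by simpa using f.map_adj_iff.2 hx)
    (by simpa using f.map_adj_iff.2 hy) (by rw [hf, hf, hxy])
  exact hno (RelIso.refl _) (f.injective hfxy)
end
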